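/- arXiv:2211.04827 — 2 statements merged into one kernel-verified Lean document; each statement's English description precedes it below -/
import Mathlib

section
/- Suppose sequences (x_k), (γ_k), (α_k), (p_k), (Φ_k) are generated by the nonmonotone proximal gradient method with backtracking information. Let x* ∈ X and let k ↦ k_j be a strictly increasing sequence of indices such that x_{k_j} → x* as j → ∞. If ∇f is Lipschitz continuous on some neighborhood of x*, then the subsequence of stepsizes is bounded away from zero: inf_j γ_{k_j} > 0. -/
open Filter Topology
open scoped RealInnerProductSpace

variable {X : Type*} [NormedAddCommGroup X] [InnerProductSpace ℝ X] [FiniteDimensional ℝ X]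

/-- The extended-real-valued composite objective `φ = f + g`. -/
noncomputable def phiE (f : X → ℝ) (g : X → EReal) (z : X) : EReal :=
  (f z : EReal) + g z

/-- `y` minimizes `z ↦ g z + ⟪v, z - x⟫ + ‖z - x‖² / (2γ)` over `X`
(a proximal gradient step from `x` with gradient vector `v` and stepsize `γ`). -/
def ProxMin (g : X → EReal) (v x : X) (γ : ℝ) (y : X) : Prop :=
  ∀ z : X,
    g y + ((⟪v, y - x⟫ + ‖y - x‖ ^ 2 / (2 * γ) : ℝ) : EReal) ≤
      g z + ((⟪v, z - x⟫ + ‖z - x‖ ^ 2 / (2 * γ) : ℝ) : EReal)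

/-- Fréchet (regular) subgradient of `h` at `xb`. -/
noncomputable def FSubgrad (h : X → EReal) (xb v : X) : Prop :=
  h xb ≠ ⊤ ∧
    0 ≤ Filter.liminf
        (fun z : X => (h z - h xb - ((⟪v, z - xb⟫ : ℝ) : EReal)) / ((‖z - xb‖ : ℝ) : EReal))
        (𝓝[≠] xb)

/-- Limiting (Mordukhovich) subgradient of `h` at `xb`. -/
noncomputable def MSubgrad (h : X → EReal) (xb v : X) : Prop :=
  h xb ≠ ⊤ ∧
    ∃ xs vs : ℕ → X,
      Tendsto xs atTop (𝓝 xb) ∧ Tendsto vs atTop (𝓝 v) ∧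
        Tendsto (fun j => h (xs j)) atTop (𝓝 (h xb)) ∧ ∀ j, FSubgrad h (xs j) (vs j)

/-- The sequences `x, γ, α, p, Φ` are generated by the nonmonotone proximal gradient
method for `φ = f + g` with parameters `γmax, αmin, αmax, pmin`. -/
structure NMPG (f : X → ℝ) (g : X → EReal) (γmax αmin αmax pmin : ℝ)
    (x : ℕ → X) (γ α p : ℕ → ℝ) (Φ : ℕ → ℝ) : Prop where
  hf : ContDiff ℝ 1 f
  hg_nebot : ∀ z, g z ≠ ⊥
  hg_proper : ∃ z, g z ≠ ⊤
  hg_lsc : LowerSemicontinuous g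
  hg_proxbdd : ∃ γ₀ : ℝ, 0 < γ₀ ∧ ∃ m : ℝ, ∀ z,
    (m : EReal) ≤ g z + ((‖z‖ ^ 2 / (2 * γ₀) : ℝ) : EReal)
  hφ_bdd : ∃ m : ℝ, ∀ z, (m : EReal) ≤ phiE f g z
  hγmax : 0 < γmax
  hαmin : 0 < αmin
  hαα : αmin ≤ αmax
  hαmax : αmax < 1
  hpmin : 0 < pmin
  hpone : pmin ≤ 1
  hx0 : g (x 0) ≠ ⊤
  hΦ0 : (Φ 0 : EReal) = phiE f g (x 0)
  hγpos : ∀ k, 0 < γ k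
  hγle : ∀ k, γ k ≤ γmax
  hαmem : ∀ k, α k ∈ Set.Icc αmin αmax
  hpmem : ∀ k, p k ∈ Set.Icc pmin 1
  hstep : ∀ k : ℕ, ProxMin g (gradient f (x k)) (x k) (γ (k + 1)) (x (k + 1))
  hls : ∀ k : ℕ, phiE f g (x (k + 1)) ≤
      ((Φ k - (1 - α (k + 1)) / (2 * γ (k + 1)) * ‖x (k + 1) - x k‖ ^ 2 : ℝ) : EReal)
  hΦrec : ∀ k : ℕ, Φ (k + 1) = (1 - p (k + 1)) * Φ k + p (k + 1) * (phiE f g (x (k + 1))).toReal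

/-- Backtracking information: for every `k`, either `γ k ≥ γmin`, or the previously
attempted stepsize `σ ∈ [γ k / βmax, γ k / βmin]` was rejected by the line search. -/
def Backtrack (f : X → ℝ) (g : X → EReal) (αmin γmin βmin βmax : ℝ)
    (x : ℕ → X) (γ : ℕ → ℝ) (Φ : ℕ → ℝ) : Prop :=
  ∀ k : ℕ, γmin ≤ γ (k + 1) ∨
    ∃ σ : ℝ, ∃ y : X, γ (k + 1) / βmax ≤ σ ∧ σ ≤ γ (k + 1) / βmin ∧
      ProxMin g (gradient f (x k)) (x k) σ y ∧
      ((Φ k - (1 - αmin) / (2 * σ) * ‖y - x k‖ ^ 2 : ℝ) : EReal) < phiE f g y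

/-- A first-order Taylor bound for a function whose gradient is Lipschitz on a convex set. -/
theorem sub_sub_inner_gradient_le_of_lipschitzOnWith {f : X → ℝ} (hf : Differentiable ℝ f)
    {s : Set X} (hs : Convex ℝ s) {L : NNReal} (hL : LipschitzOnWith L (gradient f) s)
    {u y : X} (hu : u ∈ s) (hy : y ∈ s) :
    f y - f u - ⟪gradient f u, y - u⟫ ≤ L * ‖y - u‖ ^ 2 := by
  have hseg : segment ℝ u y ⊆ s := hs.segment_subset hu hy
  have key := (convex_segment u y).norm_image_sub_le_of_norm_hasFDerivWithin_le'
    (f := f) (f' := fun z => InnerProductSpace.toDual ℝ X (gradient f z))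
    (φ := InnerProductSpace.toDual ℝ X (gradient f u)) (C := L * ‖y - u‖)
    (fun z _ => (hf z).hasGradientAt.hasFDerivAt.hasFDerivWithinAt)
    (fun z hz => by
      rw [← map_sub, LinearIsometryEquiv.norm_map]
      refine (hL.norm_sub_le (hseg hz) hu).trans ?_
      gcongr
      exact norm_sub_le_of_mem_segment hz)
    (left_mem_segment ℝ u y) (right_mem_segment ℝ u y)
  rw [InnerProductSpace.toDual_apply_apply, Real.norm_eq_abs] at key
  nlinarith [le_abs_self (f y - f u - ⟪gradient f u, y - u⟫)]

namespace ProxMin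

variable {Y : Type*} [NormedAddCommGroup Y] [InnerProductSpace ℝ Y]
  {g : Y → EReal} {v u y : Y} {σ : ℝ}

theorem ne_top (h : ProxMin g v u σ y) (hu : g u ≠ ⊤) : g y ≠ ⊤ := by
  intro hy
  have := h u
  rw [hy, EReal.top_add_coe, top_le_iff] at this
  simp [hu] at this

theorem toReal_le (h : ProxMin g v u σ y) (hbot : ∀ z, g z ≠ ⊥) (hu : g u ≠ ⊤) :
    (g y).toReal + ⟪v, y - u⟫ + ‖y - u‖ ^ 2 / (2 * σ) ≤ (g u).toReal := by
  have := h u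
  rw [← EReal.coe_toReal (h.ne_top hu) (hbot y), ← EReal.coe_toReal hu (hbot u)] at this
  norm_cast at this
  simp only [sub_self, inner_zero_right, norm_zero] at this
  norm_num at this
  linarith

end ProxMin

theorem phiE_eq_coe {Y : Type*} {f : Y → ℝ} {g : Y → EReal} {z : Y}
    (hbot : g z ≠ ⊥) (htop : g z ≠ ⊤) :
    phiE f g z = ((f z + (g z).toReal : ℝ) : EReal) := by
  rw [phiE, EReal.coe_add, EReal.coe_toReal htop hbot]

namespace NMPG

variable {f : X → ℝ} {g : X → EReal} {γmax αmin αmax pmin : ℝ} {x : ℕ → X} {γ α p Φ : ℕ → ℝ}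

theorem ne_top (h : NMPG f g γmax αmin αmax pmin x γ α p Φ) (k : ℕ) : g (x k) ≠ ⊤ := by
  induction k with
  | zero => exact h.hx0
  | succ k ih => exact (h.hstep k).ne_top ih

theorem phiE_iterate (h : NMPG f g γmax αmin αmax pmin x γ α p Φ) (k : ℕ) :
    phiE f g (x k) = ((f (x k) + (g (x k)).toReal : ℝ) : EReal) :=
  phiE_eq_coe (h.hg_nebot _) (h.ne_top k)

theorem lineSearch (h : NMPG f g γmax αmin αmax pmin x γ α p Φ) (k : ℕ) :
    (1 - αmax) / (2 * γmax) * ‖x (k + 1) - x k‖ ^ 2 ≤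
      Φ k - (f (x (k + 1)) + (g (x (k + 1))).toReal) := by
  have h1 := h.hls k
  rw [h.phiE_iterate, EReal.coe_le_coe_iff] at h1
  have h2 : (1 - αmax) / (2 * γmax) ≤ (1 - α (k + 1)) / (2 * γ (k + 1)) := by
    have := h.hγpos (k + 1)
    have := h.hγle (k + 1)
    have := (h.hαmem (k + 1)).2
    have := h.hαmax
    gcongr
    linarith
  nlinarith [sq_nonneg ‖x (k + 1) - x k‖, mul_le_mul_of_nonneg_right h2
    (sq_nonneg ‖x (k + 1) - x k‖)]

theorem decrease_coeff_pos (h : NMPG f g γmax αmin αmax pmin x γ α p Φ) :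
    0 < (1 - αmax) / (2 * γmax) :=
  div_pos (by linarith [h.hαmax]) (by linarith [h.hγmax])

theorem objective_succ_le (h : NMPG f g γmax αmin αmax pmin x γ α p Φ) (k : ℕ) :
    f (x (k + 1)) + (g (x (k + 1))).toReal ≤ Φ k := by
  have := mul_nonneg h.decrease_coeff_pos.le (sq_nonneg ‖x (k + 1) - x k‖)
  linarith [h.lineSearch k]

theorem merit_succ (h : NMPG f g γmax αmin αmax pmin x γ α p Φ) (k : ℕ) :
    Φ (k + 1) = (1 - p (k + 1)) * Φ k + p (k + 1) * (f (x (k + 1)) + (g (x (k + 1))).toReal) := by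
  rw [h.hΦrec, h.phiE_iterate, EReal.toReal_coe]

theorem objective_le (h : NMPG f g γmax αmin αmax pmin x γ α p Φ) (k : ℕ) :
    f (x k) + (g (x k)).toReal ≤ Φ k := by
  cases k with
  | zero =>
    have := h.hΦ0
    rw [h.phiE_iterate, EReal.coe_eq_coe_iff] at this
    exact this.ge
  | succ k =>
    nlinarith [h.merit_succ k, mul_nonneg (sub_nonneg.2 (h.hpmem (k + 1)).2)
      (sub_nonneg.2 (h.objective_succ_le k))]

theorem merit_decrease (h : NMPG f g γmax αmin αmax pmin x γ α p Φ) (k : ℕ) :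
    pmin * ((1 - αmax) / (2 * γmax)) * ‖x (k + 1) - x k‖ ^ 2 ≤ Φ k - Φ (k + 1) := by
  have h1 := h.lineSearch k
  have h2 := mul_le_mul_of_nonneg_right (h.hpmem (k + 1)).1
    (sub_nonneg.2 (h.objective_succ_le k))
  have h3 := mul_le_mul_of_nonneg_left h1 h.hpmin.le
  rw [h.merit_succ k]
  linarith

theorem merit_antitone (h : NMPG f g γmax αmin αmax pmin x γ α p Φ) : Antitone Φ :=
  antitone_nat_of_succ_le fun k => by
    have := mul_nonneg (mul_pos h.hpmin h.decrease_coeff_pos).le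
      (sq_nonneg ‖x (k + 1) - x k‖)
    linarith [h.merit_decrease k]

theorem tendsto_norm_step (h : NMPG f g γmax αmin αmax pmin x γ α p Φ) :
    Tendsto (fun k => ‖x (k + 1) - x k‖) atTop (𝓝 0) := by
  obtain ⟨m, hm⟩ := h.hφ_bdd
  have hbdd : BddBelow (Set.range Φ) := by
    refine ⟨m, ?_⟩
    rintro _ ⟨k, rfl⟩
    have := hm (x k)
    rw [h.phiE_iterate, EReal.coe_le_coe_iff] at this
    exact this.trans (h.objective_le k)
  have hΦ := tendsto_atTop_ciInf h.merit_antitone hbdd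
  have hc : 0 < pmin * ((1 - αmax) / (2 * γmax)) := mul_pos h.hpmin h.decrease_coeff_pos
  have hdiff : Tendsto (fun k => (Φ k - Φ (k + 1)) / (pmin * ((1 - αmax) / (2 * γmax))))
      atTop (𝓝 0) := by
    simpa using (hΦ.sub (hΦ.comp (tendsto_add_atTop_nat 1))).div_const
      (pmin * ((1 - αmax) / (2 * γmax)))
  have hsq : Tendsto (fun k => ‖x (k + 1) - x k‖ ^ 2) atTop (𝓝 0) :=
    squeeze_zero (fun k => sq_nonneg _)
      (fun k => (le_div_iff₀' hc).2 (h.merit_decrease k)) hdiff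
  simpa using hsq.sqrt

/-- Near a point around which `∇f` is Lipschitz, rejected stepsizes are bounded away from zero. -/
theorem exists_rejected_stepsize_bound (h : NMPG f g γmax αmin αmax pmin x γ α p Φ)
    {xstar : X} {U : Set X} (hU : U ∈ 𝓝 xstar) {L : NNReal}
    (hLip : LipschitzOnWith L (gradient f) U) :
    ∃ V ∈ 𝓝 xstar, ∃ K : ℝ, 0 < K ∧ ∀ (k : ℕ) (σ : ℝ) (y : X), x k ∈ V → 0 < σ →
      ProxMin g (gradient f (x k)) (x k) σ y →
      ((Φ k - (1 - αmin) / (2 * σ) * ‖y - x k‖ ^ 2 : ℝ) : EReal) < phiE f g y →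
      1 / (2 * σ) < K := by
  obtain ⟨r, hr, hrU⟩ := Metric.mem_nhds_iff.1 hU
  obtain ⟨γ₀, hγ₀, m, hm⟩ := h.hg_proxbdd
  have hfc : ∀ᶠ u in 𝓝 xstar, f xstar - 1 < f u :=
    h.hf.continuous.continuousAt.eventually (lt_mem_nhds (by linarith))
  set R := ‖xstar‖ + r / 2 with hR
  set G := ‖gradient f xstar‖ + L * (r / 2) with hG
  set C := Φ 0 - (f xstar - 1) - m + R ^ 2 / γ₀ + G ^ 2 / 2 with hC
  have hα := h.hαmin
  refine ⟨Metric.ball xstar (r / 2) ∩ {u | f xstar - 1 < f u},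
    inter_mem (Metric.ball_mem_nhds _ (by linarith)) hfc,
    1 / γ₀ + 1 / 2 + (|C| + 1) / (r / 2) ^ 2 + L / αmin, by positivity, ?_⟩
  rintro k σ y ⟨hball, hfu⟩ hσ hprox hrej
  by_contra! hK
  have hfu : f xstar - 1 < f (x k) := hfu
  have hdist : ‖x k - xstar‖ < r / 2 := mem_ball_iff_norm.1 hball
  have huU : x k ∈ Metric.ball xstar r := Metric.ball_subset_ball (by linarith) hball
  have hyt := hprox.ne_top (h.ne_top k)
  have hdesc := hprox.toReal_le h.hg_nebot (h.ne_top k)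
  rw [phiE_eq_coe (h.hg_nebot y) hyt, EReal.coe_lt_coe_iff] at hrej
  have hobj := h.objective_le k
  have hΦ0 : Φ k ≤ Φ 0 := h.merit_antitone (Nat.zero_le k)
  have hgy : m ≤ (g y).toReal + ‖y‖ ^ 2 / (2 * γ₀) := by
    have := hm y
    rw [← EReal.coe_toReal hyt (h.hg_nebot y)] at this
    exact_mod_cast this
  have hgrad : ‖gradient f (x k)‖ ≤ G := by
    have h1 := hLip.norm_sub_le (hrU huU) (hrU (Metric.mem_ball_self hr))
    have h2 := norm_le_norm_add_norm_sub' (gradient f (x k)) (gradient f xstar)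
    have h3 : (L : ℝ) * ‖x k - xstar‖ ≤ L * (r / 2) := by gcongr
    linarith
  have hxR : ‖x k‖ ≤ R := by
    have := norm_le_norm_add_norm_sub' (x k) xstar
    linarith
  set d := ‖y - x k‖ with hd
  have hd0 : 0 ≤ d := norm_nonneg _
  have hinner : -(G * d) ≤ ⟪gradient f (x k), y - x k⟫ := by
    have h1 := neg_le_of_abs_le (abs_real_inner_le_norm (gradient f (x k)) (y - x k))
    have h2 : ‖gradient f (x k)‖ * ‖y - x k‖ ≤ G * d := by gcongr
    linarith
  have hyn : ‖y‖ ^ 2 / (2 * γ₀) ≤ (R ^ 2 + d ^ 2) * (1 / γ₀) := by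
    have h1 : ‖y‖ ≤ R + d := by
      have := norm_le_norm_add_norm_sub' y (x k)
      linarith
    have h2 : ‖y‖ ^ 2 ≤ 2 * (R ^ 2 + d ^ 2) := by
      nlinarith [norm_nonneg y, sq_nonneg (R - d)]
    calc ‖y‖ ^ 2 / (2 * γ₀) ≤ 2 * (R ^ 2 + d ^ 2) / (2 * γ₀) := by gcongr
      _ = _ := by field_simp
  clear_value d C G R
  have hstep : d ^ 2 / (2 * σ) = d ^ 2 * (1 / (2 * σ)) := by ring
  have hLα : 0 ≤ (L : ℝ) / αmin := by positivity
  have hrem : 0 ≤ (|C| + 1) / (r / 2) ^ 2 := by positivity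
  have hγ₀' : 0 ≤ 1 / γ₀ := by positivity
  have hbound : d ^ 2 * ((|C| + 1) / (r / 2) ^ 2) ≤ C := by
    have h1 : d ^ 2 * (1 / γ₀ + 1 / 2 + (|C| + 1) / (r / 2) ^ 2) ≤ d ^ 2 * (1 / (2 * σ)) := by
      gcongr
      linarith
    have h2 : R ^ 2 / γ₀ = R ^ 2 * (1 / γ₀) := by ring
    linarith [sq_nonneg (G - d)]
  have hdr : d < r / 2 := by
    rw [← mul_div_assoc, div_le_iff₀ (by positivity)] at hbound
    by_contra! hcon
    have h1 : (r / 2) ^ 2 ≤ d ^ 2 := by gcongr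
    nlinarith [le_abs_self C, abs_nonneg C, sq_pos_of_pos (half_pos hr)]
  have hyU : y ∈ Metric.ball xstar r := by
    rw [mem_ball_iff_norm]
    have := norm_sub_le_norm_sub_add_norm_sub y (x k) xstar
    linarith
  have htaylor := sub_sub_inner_gradient_le_of_lipschitzOnWith (h.hf.differentiable one_ne_zero)
    (convex_ball xstar r) (hLip.mono hrU) huU hyU
  rw [← hd] at htaylor
  have hLσ : (L : ℝ) ≤ αmin * (1 / (2 * σ)) := by
    rw [← div_le_iff₀' hα]
    linarith
  have hLd : L * d ^ 2 ≤ αmin * (1 / (2 * σ)) * d ^ 2 := by gcongr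
  have hsplit : (1 - αmin) / (2 * σ) * d ^ 2 =
      d ^ 2 * (1 / (2 * σ)) - αmin * (1 / (2 * σ)) * d ^ 2 := by ring
  linarith

end NMPG

/-- A sequence of positive reals that is eventually bounded away from zero is so everywhere. -/
theorem exists_pos_forall_le_of_eventually {u : ℕ → ℝ} (hu : ∀ j, 0 < u j) {c : ℝ} (hc : 0 < c)
    (hev : ∀ᶠ j in atTop, c ≤ u j) : ∃ c' : ℝ, 0 < c' ∧ ∀ j, c' ≤ u j := by
  obtain ⟨N, hN⟩ := eventually_atTop.1 hev
  obtain ⟨i, -, hi⟩ := (Finset.range (N + 1)).exists_min_image u ⟨0, by simp⟩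
  refine ⟨min c (u i), lt_min hc (hu i), fun j => ?_⟩
  rcases le_total N j with hj | hj
  · exact (min_le_left _ _).trans (hN j hj)
  · exact (min_le_right _ _).trans (hi j (Finset.mem_range.2 (by omega)))

theorem stmt_6 (f : X → ℝ) (g : X → EReal) (γmax αmin αmax pmin : ℝ)
    (x : ℕ → X) (γ α p : ℕ → ℝ) (Φ : ℕ → ℝ)
    (h : NMPG f g γmax αmin αmax pmin x γ α p Φ)
    (γmin βmin βmax : ℝ) (hγmin : 0 < γmin) (hβmin : 0 < βmin)
    (hββ : βmin ≤ βmax) (hβmax : βmax < 1)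
    (hbt : Backtrack f g αmin γmin βmin βmax x γ Φ)
    (xstar : X) (ks : ℕ → ℕ) (hks : StrictMono ks)
    (hconv : Tendsto (fun j => x (ks j)) atTop (𝓝 xstar))
    (U : Set X) (hU : U ∈ 𝓝 xstar) (L : NNReal)
    (hLip : LipschitzOnWith L (gradient f) U) :
    ∃ c : ℝ, 0 < c ∧ ∀ j : ℕ, c ≤ γ (ks j) := by
  obtain ⟨V, hV, K, hK, hrej⟩ := h.exists_rejected_stepsize_bound hU hLip
  have hprev : Tendsto (fun j => x (ks j - 1)) atTop (𝓝 xstar) := by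
    have hks' : Tendsto (fun j => ks j - 1) atTop atTop :=
      (tendsto_sub_atTop_nat 1).comp hks.tendsto_atTop
    have hsub : Tendsto (fun j => x (ks j - 1 + 1) - x (ks j - 1)) atTop (𝓝 0) :=
      tendsto_zero_iff_norm_tendsto_zero.2 (h.tendsto_norm_step.comp hks')
    have hlim := hconv.sub hsub
    rw [sub_zero] at hlim
    refine hlim.congr' ?_
    filter_upwards [eventually_ge_atTop 1] with j hj
    rw [Nat.sub_add_cancel (hj.trans hks.le_apply), sub_sub_cancel]
  refine exists_pos_forall_le_of_eventually (fun j => h.hγpos (ks j))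
    (c := min γmin (βmin / (2 * K))) (lt_min hγmin (by positivity)) ?_
  filter_upwards [eventually_ge_atTop 1, hprev hV] with j hj hjV
  obtain ⟨k, hk⟩ : ∃ k, ks j = k + 1 := Nat.exists_eq_add_of_le' (hj.trans hks.le_apply)
  have hkV : x k ∈ V := by simpa [hk] using hjV
  rw [hk]
  rcases hbt k with hγ | ⟨σ, y, hσlo, hσhi, hprox, hlt⟩
  · exact (min_le_left _ _).trans hγ
  · have hσ : 0 < σ := (div_pos (h.hγpos (k + 1)) (hβmin.trans_le hββ)).trans_le hσlo
    have hσK := hrej k σ y hkV hσ hprox hlt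
    refine (min_le_right _ _).trans ?_
    rw [le_div_iff₀ hβmin] at hσhi
    rw [div_lt_iff₀ (by positivity)] at hσK
    rw [div_le_iff₀ (by positivity)]
    nlinarith
end

section
/- Let X be a finite-dimensional real inner product space, f : X → ℝ differentiable, g : X → ℝ ∪ {∞} proper, and φ := f + g. Let x ∈ X, γ > 0, and let x̄ be a minimizer over X of z ↦ g(z) + ⟨∇f(x), z − x⟩ + (1/(2γ))‖z − x‖². Then g(x̄) < ∞ and the vector v := (1/γ)(x − x̄) − ∇f(x) + ∇f(x̄) is a Fréchet subgradient of φ at x̄, i.e., v ∈ ∂̂φ(x̄). In particular, dist(0, ∂̂φ(x̄)) ≤ ‖(1/γ)(x − x̄) − ∇f(x) + ∇f(x̄)‖. -/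
open Filter Topology
open scoped RealInnerProductSpace

variable {X : Type*} [NormedAddCommGroup X] [InnerProductSpace ℝ X] [FiniteDimensional ℝ X]

/-- It suffices to bound the difference quotients below by every negative real, eventually. -/
lemma EReal.zero_le_liminf_of_forall_neg {α : Type*} {l : Filter α} {u : α → EReal}
    (h : ∀ ε : ℝ, 0 < ε → ∀ᶠ a in l, ((-ε : ℝ) : EReal) ≤ u a) : 0 ≤ Filter.liminf u l := by
  refine le_of_forall_lt fun c hc => ?_
  obtain ⟨r, hcr, hr⟩ := EReal.lt_iff_exists_real_btwn.1 hc
  have hr' : r < 0 := by exact_mod_cast hr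
  refine hcr.trans_le (Filter.le_liminf_of_le (by isBoundedDefault) ?_)
  simpa using h (-r) (by linarith)

/-- A proximal step has finite `g`-value as soon as `g` is finite somewhere. -/
lemma ProxMin.ne_top_s10 {Y : Type*} [NormedAddCommGroup Y] [InnerProductSpace ℝ Y]
    [FiniteDimensional ℝ Y] {g : Y → EReal} {v x y : Y} {γ : ℝ} (h : ProxMin g v x γ y)
    (hg : ∃ z, g z ≠ ⊤) : g y ≠ ⊤ := by
  obtain ⟨z, hz⟩ := hg
  intro hy
  have hle := h z
  rw [hy, EReal.top_add_coe, top_le_iff] at hle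
  exact EReal.add_ne_top hz (EReal.coe_ne_top _) hle

/-- The real-variable form of the proximal inequality, expanded around the minimizer. -/
lemma ProxMin.sub_ge {Y : Type*} [NormedAddCommGroup Y] [InnerProductSpace ℝ Y]
    [FiniteDimensional ℝ Y] {g : Y → EReal} {v x y : Y} {γ : ℝ} (h : ProxMin g v x γ y)
    {a b : ℝ} {z : Y} (ha : g y = a) (hb : g z = b) :
    1 / γ * ⟪x - y, z - y⟫ - ⟪v, z - y⟫ - ‖z - y‖ ^ 2 / (2 * γ) ≤ b - a := by
  have hle := h z
  rw [ha, hb] at hle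
  norm_cast at hle
  have hsplit : z - x = (z - y) - (x - y) := by abel
  have hn : ‖z - x‖ ^ 2 = ‖z - y‖ ^ 2 - 2 * ⟪x - y, z - y⟫ + ‖y - x‖ ^ 2 := by
    rw [hsplit, norm_sub_sq_real, real_inner_comm, norm_sub_rev y x]
  have hi : ⟪v, z - x⟫ = ⟪v, z - y⟫ + ⟪v, y - x⟫ := by
    rw [← inner_add_right, sub_add_sub_cancel]
  rw [hn, hi] at hle
  have he : (‖z - y‖ ^ 2 - 2 * ⟪x - y, z - y⟫ + ‖y - x‖ ^ 2) / (2 * γ) =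
      ‖z - y‖ ^ 2 / (2 * γ) - 1 / γ * ⟪x - y, z - y⟫ + ‖y - x‖ ^ 2 / (2 * γ) := by
    ring
  linarith

/-- A proximal gradient step yields an explicit Fréchet subgradient of `f + g`. -/
lemma ProxMin.fSubgrad {Y : Type*} [NormedAddCommGroup Y] [InnerProductSpace ℝ Y]
    [FiniteDimensional ℝ Y] {f : Y → ℝ} {g : Y → EReal} {v x y : Y} {γ : ℝ}
    (h : ProxMin g v x γ y) (hf : DifferentiableAt ℝ f y) (hg_nebot : ∀ z, g z ≠ ⊥)
    (hy : g y ≠ ⊤) (hγ : 0 < γ) :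
    FSubgrad (phiE f g) y ((1 / γ) • (x - y) - v + gradient f y) := by
  obtain ⟨a, ha⟩ : ∃ a : ℝ, g y = a := ⟨_, (EReal.coe_toReal hy (hg_nebot y)).symm⟩
  refine ⟨EReal.add_ne_top (EReal.coe_ne_top _) hy,
    EReal.zero_le_liminf_of_forall_neg fun ε hε => ?_⟩
  have hlin := (hasGradientAt_iff_isLittleO.1 hf.hasGradientAt).def (half_pos hε)
  have hball := Metric.ball_mem_nhds y (mul_pos hγ hε)
  filter_upwards [self_mem_nhdsWithin, nhdsWithin_le_nhds hlin, nhdsWithin_le_nhds hball]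
    with z hzy hfz hz
  have hpos : 0 < ‖z - y‖ := norm_pos_iff.2 (sub_ne_zero.2 hzy)
  rw [EReal.le_div_iff_mul_le (by exact_mod_cast hpos) (EReal.coe_ne_top _)]
  by_cases hgz : g z = ⊤
  · simp [phiE, hgz, ha, ← EReal.coe_add]
  obtain ⟨b, hb⟩ : ∃ b : ℝ, g z = b := ⟨_, (EReal.coe_toReal hgz (hg_nebot z)).symm⟩
  simp only [phiE, ha, hb]
  norm_cast
  have hprox := h.sub_ge ha hb
  rw [Real.norm_eq_abs, abs_le] at hfz
  rw [mem_ball_iff_norm] at hz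
  have hquad : ‖z - y‖ ^ 2 / (2 * γ) ≤ ε / 2 * ‖z - y‖ := by
    rw [div_le_iff₀ (by positivity)]
    nlinarith
  rw [inner_add_left, inner_sub_left, real_inner_smul_left]
  linarith [hfz.1]

theorem stmt_10 (f : X → ℝ) (g : X → EReal)
    (hf : Differentiable ℝ f) (hg_nebot : ∀ z, g z ≠ ⊥) (hg_proper : ∃ z, g z ≠ ⊤)
    (x : X) (γ : ℝ) (hγ : 0 < γ) (xbar : X)
    (hmin : ProxMin g (gradient f x) x γ xbar) :
    g xbar ≠ ⊤ ∧
      FSubgrad (phiE f g) xbar ((1 / γ) • (x - xbar) - gradient f x + gradient f xbar) ∧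
      Metric.infDist 0 {w : X | FSubgrad (phiE f g) xbar w} ≤
        ‖(1 / γ) • (x - xbar) - gradient f x + gradient f xbar‖ := by
  have hfin := hmin.ne_top_s10 hg_proper
  have hsub := hmin.fSubgrad (hf xbar) hg_nebot hfin hγ
  refine ⟨hfin, hsub, ?_⟩
  rw [← dist_zero_left]
  exact Metric.infDist_le_dist_of_mem hsub
end
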